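/- arXiv:0707.2360 — 2 statements merged into one kernel-verified Lean document; each statement's English description precedes it below -/
import Mathlib

section
/- For every k ∈ {0, 4, 8, 12, 72, 76, 128, 132, 136, 140, 200}, Wolfram rule k is ω-independent, i.e., for every n > 3 and all update orders ω, ω' on ZMod n, Per[k,ω]_n = Per[k,ω']_n. -/
/-- State of the ACA: a cyclic binary string indexed by `ZMod n`. -/
abbrev AcaState (n : ℕ) := ZMod n → Fin 2

/-- Wolfram rule `k` applied at vertex `i`: update coordinate `i` to the binary
digit `a_j` of `k`, where `j = 4·y(i-1) + 2·y(i) + y(i+1)`. -/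
def wolfRule (n k : ℕ) (i : ZMod n) (y : AcaState n) : AcaState n :=
  Function.update y i
    (if Nat.testBit k (4 * (y (i - 1)).val + 2 * (y i).val + (y (i + 1)).val)
     then 1 else 0)

/-- The ACA map `[k,ω]ₙ = Wolf_{ω_m} ∘ ⋯ ∘ Wolf_{ω_1}`. -/
def acaMap (n k : ℕ) (ω : List (ZMod n)) (y : AcaState n) : AcaState n :=
  ω.foldl (fun s i => wolfRule n k i s) y

/-- An update order: a list containing every vertex at least once. -/
def IsUpdateOrder (n : ℕ) (ω : List (ZMod n)) : Prop :=
  ∀ v : ZMod n, v ∈ ω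

/-- A simple update order: a list containing every vertex exactly once. -/
def IsSimpleUpdateOrder (n : ℕ) (ω : List (ZMod n)) : Prop :=
  ω.Nodup ∧ ∀ v : ZMod n, v ∈ ω

/-- `y` is periodic for `F` if some positive iterate of `F` returns `y` to itself. -/
def IsPeriodicState {α : Type*} (F : α → α) (y : α) : Prop :=
  ∃ m : ℕ, 1 ≤ m ∧ F^[m] y = y

/-- `Per[k,ω]ₙ`: the set of periodic states of the ACA map. -/
def perSet (n k : ℕ) (ω : List (ZMod n)) : Set (AcaState n) :=
  {y | IsPeriodicState (acaMap n k ω) y}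

/-- Rule `k` is ω-independent on `Circ n`. -/
def OmegaIndepOn (n k : ℕ) : Prop :=
  ∀ ω ω' : List (ZMod n), IsUpdateOrder n ω → IsUpdateOrder n ω' →
    perSet n k ω = perSet n k ω'

/-- Rule `k` is ω-independent: ω-independent on `Circ n` for every `n > 3`. -/
def OmegaIndep (k : ℕ) : Prop :=
  ∀ n : ℕ, 3 < n → OmegaIndepOn n k

/-- If `k` never turns a `0` into a `1`, applying Wolfram rule `k` at a vertex does not increase
the state. -/
theorem wolfRule_le {n k : ℕ} (hk : ∀ a c : Fin 2, Nat.testBit k (4 * a.val + c.val) = false)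
    (i : ZMod n) (y : AcaState n) : wolfRule n k i y ≤ y := by
  refine update_le_self_iff.2 ?_
  obtain h | h : y i = 0 ∨ y i = 1 := by lia
  · simp [h, hk]
  · rw [h]
    exact Fin.le_last _

theorem acaMap_le {n k : ℕ} (hk : ∀ a c : Fin 2, Nat.testBit k (4 * a.val + c.val) = false)
    (ω : List (ZMod n)) (y : AcaState n) : acaMap n k ω y ≤ y := by
  induction ω generalizing y with
  | nil => exact le_rfl
  | cons i ω ih => exact (ih (wolfRule n k i y)).trans (wolfRule_le hk i y)

theorem acaMap_eq_self_iff {n k : ℕ}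
    (hk : ∀ a c : Fin 2, Nat.testBit k (4 * a.val + c.val) = false)
    (ω : List (ZMod n)) (y : AcaState n) :
    acaMap n k ω y = y ↔ ∀ i ∈ ω, wolfRule n k i y = y := by
  induction ω with
  | nil => simp [acaMap]
  | cons i ω ih =>
    rw [List.forall_mem_cons, ← ih]
    change acaMap n k ω (wolfRule n k i y) = y ↔ _
    constructor
    · intro h
      have hi : wolfRule n k i y = y :=
        (wolfRule_le hk i y).antisymm (h.ge.trans (acaMap_le hk ω _))
      rw [hi] at h
      exact ⟨hi, h⟩
    · rintro ⟨hi, h⟩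
      rw [hi, h]

/-- The periodic states of a map that never increases its argument are its fixed points. -/
theorem isPeriodicState_iff_of_le {α : Type*} [PartialOrder α] {F : α → α} (hF : ∀ y, F y ≤ y)
    (y : α) : IsPeriodicState F y ↔ F y = y := by
  refine ⟨?_, fun h => ⟨1, le_rfl, h⟩⟩
  rintro ⟨m, hm, h⟩
  obtain ⟨m, rfl⟩ := Nat.exists_eq_add_of_le' hm
  refine (hF y).antisymm ?_
  rw [Function.iterate_succ_apply] at h
  exact h.ge.trans (Function.iterate_le_id_of_le_id hF m (F y))

theorem mem_perSet_iff {n k : ℕ}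
    (hk : ∀ a c : Fin 2, Nat.testBit k (4 * a.val + c.val) = false)
    {ω : List (ZMod n)} (hω : IsUpdateOrder n ω) (y : AcaState n) :
    y ∈ perSet n k ω ↔ ∀ i, wolfRule n k i y = y :=
  (isPeriodicState_iff_of_le (acaMap_le hk ω) y).trans <|
    (acaMap_eq_self_iff hk ω y).trans ⟨fun h i => h i (hω i), fun h i _ => h i⟩

theorem omegaIndep_of_testBit_eq_false {k : ℕ}
    (hk : ∀ a c : Fin 2, Nat.testBit k (4 * a.val + c.val) = false) : OmegaIndep k :=
  fun _ _ _ _ hω hω' => Set.ext fun y =>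
    (mem_perSet_iff hk hω y).trans (mem_perSet_iff hk hω' y).symm

/-- Rules 0, 4, 8, 12, 72, 76, 128, 132, 136, 140 and 200 are ω-independent. -/
theorem one_way_rules_omegaIndep (k : ℕ)
    (hk : k ∈ ({0, 4, 8, 12, 72, 76, 128, 132, 136, 140, 200} : Set ℕ)) :
    OmegaIndep k := by
  apply omegaIndep_of_testBit_eq_false
  simp only [Set.mem_insert_iff, Set.mem_singleton_iff] at hk
  rcases hk with rfl | rfl | rfl | rfl | rfl | rfl | rfl | rfl | rfl | rfl | rfl <;> decide
end

section
/- Let k ∈ {1, 9, 73, 129, 137} have binary digits a_0,…,a_7. For every n > 3 and every update order ω on ZMod n, Per[k,ω]_n equals the set P of all states y such that: if a_3 = 0 then there is no i ∈ ZMod n with (y(i−1), y(i), y(i+1)) = (0,1,1); if a_6 = 0 then there is no i with (y(i−1), y(i), y(i+1)) = (1,1,0); and if a_7 = 0 then there is no i with (y(i−1), y(i), y(i+1)) = (1,1,1). In particular, Per[k,ω]_n does not depend on ω. -/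
/-- The left endpoints of the edges of the cycle on which `y` takes the value `1` twice. -/
def onePairs {n : ℕ} (y : AcaState n) : Set (ZMod n) :=
  {j | y j = 1 ∧ y (j + 1) = 1}

/-- The vertex `i` lies in a run of at least two ones of `y`, and rule `k` sends it to `0`. -/
def Erodes {n : ℕ} (k : ℕ) (y : AcaState n) (i : ZMod n) : Prop :=
  y i = 1 ∧ (y (i - 1) = 1 ∨ y (i + 1) = 1) ∧
    Nat.testBit k (4 * (y (i - 1)).val + 2 * (y i).val + (y (i + 1)).val) = false

/-- Rule `k` turns an isolated vertex on and off, and creates no pair of adjacent ones. -/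
def TogglesIsolated (k : ℕ) : Prop :=
  Nat.testBit k 0 = true ∧ Nat.testBit k 1 = false ∧ Nat.testBit k 2 = false ∧
    Nat.testBit k 4 = false ∧ Nat.testBit k 5 = false

theorem fin_two_eq_zero_or_one (v : Fin 2) : v = 0 ∨ v = 1 := by
  fin_cases v <;> simp

section
variable {n k : ℕ}

theorem wolfRule_apply_self (i : ZMod n) (y : AcaState n) :
    wolfRule n k i y i =
      if Nat.testBit k (4 * (y (i - 1)).val + 2 * (y i).val + (y (i + 1)).val)
      then 1 else 0 := by
  simp [wolfRule]

theorem wolfRule_apply_of_ne {i j : ZMod n} (h : j ≠ i) (y : AcaState n) :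
    wolfRule n k i y j = y j := by
  simp [wolfRule, h]

theorem onePairs_wolfRule_subset [Fact (1 < n)] (hk : TogglesIsolated k) (i : ZMod n)
    (y : AcaState n) : onePairs (wolfRule n k i y) ⊆ onePairs y := by
  obtain ⟨h0, h1, h2, h4, h5⟩ := hk
  rintro j ⟨hj, hj'⟩
  have hs := wolfRule_apply_self (k := k) i y
  by_cases hji : j = i
  · subst hji
    rw [wolfRule_apply_of_ne (by simp)] at hj'
    refine ⟨?_, hj'⟩
    rw [hs] at hj
    rcases fin_two_eq_zero_or_one (y j) with h | h <;>
    rcases fin_two_eq_zero_or_one (y (j - 1)) with h' | h' <;>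
    simp_all
  by_cases hji' : j + 1 = i
  · subst hji'
    rw [wolfRule_apply_of_ne (by simp)] at hj
    refine ⟨hj, ?_⟩
    rw [hs] at hj'
    rcases fin_two_eq_zero_or_one (y (j + 1)) with h | h <;>
    rcases fin_two_eq_zero_or_one (y (j + 1 + 1)) with h' | h' <;>
    simp_all
  rw [wolfRule_apply_of_ne hji] at hj
  rw [wolfRule_apply_of_ne hji'] at hj'
  exact ⟨hj, hj'⟩

theorem onePairs_wolfRule_ne_of_erodes {i : ZMod n} {y : AcaState n}
    (h : Erodes k y i) : onePairs (wolfRule n k i y) ≠ onePairs y := by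
  obtain ⟨hi, hn, hb⟩ := h
  have hs : wolfRule n k i y i = 0 := by rw [wolfRule_apply_self, hb]; rfl
  intro he
  rcases hn with hn | hn
  · have hm : i - 1 ∈ onePairs y := ⟨hn, by simpa using hi⟩
    rw [← he] at hm
    simpa [hs] using hm.2
  · have hm : i ∈ onePairs y := ⟨hi, hn⟩
    rw [← he] at hm
    simpa [hs] using hm.1

theorem Erodes.of_onePairs_eq {i : ZMod n} {y z : AcaState n}
    (h : Erodes k y i) (he : onePairs z = onePairs y) : Erodes k z i := by
  have hl := Set.ext_iff.1 he (i - 1)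
  have hr := Set.ext_iff.1 he i
  simp only [onePairs, Set.mem_ofPred_eq, sub_add_cancel] at hl hr
  obtain ⟨hi, hn, hb⟩ := h
  have hz : z i = 1 := by tauto
  have hzl : z (i - 1) = y (i - 1) := by
    rcases fin_two_eq_zero_or_one (y (i - 1)) with h | h <;>
    rcases fin_two_eq_zero_or_one (z (i - 1)) with h' | h' <;> simp_all
  have hzr : z (i + 1) = y (i + 1) := by
    rcases fin_two_eq_zero_or_one (y (i + 1)) with h | h <;>
    rcases fin_two_eq_zero_or_one (z (i + 1)) with h' | h' <;> simp_all
  refine ⟨hz, by rwa [hzl, hzr], ?_⟩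
  rwa [hzl, hzr, hz, ← hi]

theorem wolfRule_wolfRule_of_not_erodes [Fact (1 < n)] (hk : TogglesIsolated k) {i : ZMod n}
    {y : AcaState n} (h : ¬ Erodes k y i) : wolfRule n k i (wolfRule n k i y) = y := by
  obtain ⟨h0, h1, h2, h4, h5⟩ := hk
  funext j
  by_cases hji : j = i
  · subst hji
    rw [wolfRule_apply_self, wolfRule_apply_of_ne (j := j - 1) (by simp),
      wolfRule_apply_of_ne (j := j + 1) (by simp), wolfRule_apply_self]
    unfold Erodes at h
    rcases fin_two_eq_zero_or_one (y j) with ha | ha <;>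
    rcases fin_two_eq_zero_or_one (y (j - 1)) with hb | hb <;>
    rcases fin_two_eq_zero_or_one (y (j + 1)) with hc | hc <;>
    simp_all
  · rw [wolfRule_apply_of_ne hji, wolfRule_apply_of_ne hji]

theorem onePairs_wolfRule_of_not_erodes [Fact (1 < n)] (hk : TogglesIsolated k) {i : ZMod n}
    {y : AcaState n} (h : ¬ Erodes k y i) : onePairs (wolfRule n k i y) = onePairs y := by
  refine (onePairs_wolfRule_subset hk i y).antisymm ?_
  have := onePairs_wolfRule_subset hk i (wolfRule n k i y)
  rwa [wolfRule_wolfRule_of_not_erodes hk h] at this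

theorem onePairs_acaMap_subset [Fact (1 < n)] (hk : TogglesIsolated k) (ω : List (ZMod n))
    (y : AcaState n) : onePairs (acaMap n k ω y) ⊆ onePairs y := by
  induction ω generalizing y with
  | nil => exact subset_rfl
  | cons i ω ih => exact (ih _).trans (onePairs_wolfRule_subset hk i y)

theorem onePairs_iterate_acaMap_subset [Fact (1 < n)] (hk : TogglesIsolated k)
    (ω : List (ZMod n)) (m : ℕ) (y : AcaState n) :
    onePairs ((acaMap n k ω)^[m] y) ⊆ onePairs y := by
  induction m generalizing y with
  | zero => exact subset_rfl
  | succ m ih => exact (ih _).trans (onePairs_acaMap_subset hk ω y)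

theorem not_erodes_of_onePairs_acaMap_eq [Fact (1 < n)] (hk : TogglesIsolated k)
    {ω : List (ZMod n)} {y : AcaState n} (h : onePairs (acaMap n k ω y) = onePairs y)
    {i : ZMod n} (hi : i ∈ ω) : ¬ Erodes k y i := by
  induction ω generalizing y with
  | nil => simp at hi
  | cons j ω ih =>
    have hj : onePairs (wolfRule n k j y) = onePairs y :=
      (onePairs_wolfRule_subset hk j y).antisymm
        (h.ge.trans (onePairs_acaMap_subset hk ω (wolfRule n k j y)))
    intro he
    rcases List.mem_cons.1 hi with rfl | hi
    · exact onePairs_wolfRule_ne_of_erodes he hj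
    · exact ih (y := wolfRule n k j y) (h.trans hj.symm) hi (he.of_onePairs_eq hj)

theorem mapsTo_wolfRule [Fact (1 < n)] (hk : TogglesIsolated k) (i : ZMod n) :
    Set.MapsTo (wolfRule n k i) {y | ∀ j, ¬ Erodes k y j} {y | ∀ j, ¬ Erodes k y j} :=
  fun _ hy j hj => hy j (hj.of_onePairs_eq (onePairs_wolfRule_of_not_erodes hk (hy i)).symm)

theorem mapsTo_acaMap [Fact (1 < n)] (hk : TogglesIsolated k) (ω : List (ZMod n)) :
    Set.MapsTo (acaMap n k ω) {y | ∀ j, ¬ Erodes k y j} {y | ∀ j, ¬ Erodes k y j} := by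
  induction ω with
  | nil => exact Set.mapsTo_id _
  | cons i ω ih => exact ih.comp (mapsTo_wolfRule hk i)

theorem injOn_acaMap [Fact (1 < n)] (hk : TogglesIsolated k) (ω : List (ZMod n)) :
    Set.InjOn (acaMap n k ω) {y | ∀ j, ¬ Erodes k y j} := by
  induction ω with
  | nil => exact Set.injOn_id _
  | cons i ω ih =>
    have hi : Set.LeftInvOn (wolfRule n k i) (wolfRule n k i) {y | ∀ j, ¬ Erodes k y j} :=
      fun _ hy => wolfRule_wolfRule_of_not_erodes hk (hy i)
    exact ih.comp hi.injOn (mapsTo_wolfRule hk i)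

theorem perSet_eq_setOf_not_erodes [Fact (1 < n)] (hk : TogglesIsolated k)
    {ω : List (ZMod n)} (hω : IsUpdateOrder n ω) :
    perSet n k ω = {y | ∀ i, ¬ Erodes k y i} := by
  have : NeZero n := ⟨(zero_lt_one.trans (Fact.out : 1 < n)).ne'⟩
  ext y
  constructor
  · rintro ⟨m, hm, hy⟩ i
    obtain ⟨m, rfl⟩ := Nat.exists_eq_add_of_le' hm
    refine not_erodes_of_onePairs_acaMap_eq hk (ω := ω) ?_ (hω i)
    refine (onePairs_acaMap_subset hk ω y).antisymm ?_
    have hsub := onePairs_iterate_acaMap_subset hk ω m (acaMap n k ω y)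
    rwa [← Function.iterate_succ_apply, hy] at hsub
  · intro hy
    have hmaps := mapsTo_acaMap hk ω
    have hinj : Function.Injective hmaps.restrict :=
      hmaps.restrict_inj.2 (injOn_acaMap hk ω)
    obtain ⟨m, hm, hper⟩ := hinj.mem_periodicPts ⟨y, hy⟩
    refine ⟨m, hm, ?_⟩
    have hval := congrArg Subtype.val hper.eq
    rwa [hmaps.iterate_restrict] at hval

theorem forall_not_erodes_iff (y : AcaState n) :
    (∀ i, ¬ Erodes k y i) ↔
      (Nat.testBit k 3 = false →
        ∀ i : ZMod n, ¬(y (i - 1) = 0 ∧ y i = 1 ∧ y (i + 1) = 1)) ∧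
      (Nat.testBit k 6 = false →
        ∀ i : ZMod n, ¬(y (i - 1) = 1 ∧ y i = 1 ∧ y (i + 1) = 0)) ∧
      (Nat.testBit k 7 = false →
        ∀ i : ZMod n, ¬(y (i - 1) = 1 ∧ y i = 1 ∧ y (i + 1) = 1)) := by
  constructor
  · intro h
    refine ⟨fun hb i ⟨hl, hi, hr⟩ => h i ?_, fun hb i ⟨hl, hi, hr⟩ => h i ?_,
      fun hb i ⟨hl, hi, hr⟩ => h i ?_⟩ <;>
    simp [Erodes, hl, hi, hr, hb]
  · rintro ⟨h3, h6, h7⟩ i ⟨hi, hn, hb⟩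
    rcases fin_two_eq_zero_or_one (y (i - 1)) with hl | hl <;>
    rcases fin_two_eq_zero_or_one (y (i + 1)) with hr | hr <;>
    simp only [hl, hi, hr] at hn hb
    · simp at hn
    · exact h3 hb i ⟨hl, hi, hr⟩
    · exact h6 hb i ⟨hl, hi, hr⟩
    · exact h7 hb i ⟨hl, hi, hr⟩

end

/-- For rules 1, 9, 73, 129 and 137, the set of periodic states is exactly the
set of states avoiding the forbidden substrings `011`, `110`, `111` at the
digit positions of `k` that are zero; in particular it is independent of the
update order. -/
theorem rules_D_periodic_set (k : ℕ)
    (hk : k ∈ ({1, 9, 73, 129, 137} : Set ℕ))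
    (n : ℕ) (hn : 3 < n) (ω : List (ZMod n)) (hω : IsUpdateOrder n ω) :
    perSet n k ω =
      {y : AcaState n |
        (Nat.testBit k 3 = false →
          ∀ i : ZMod n, ¬(y (i - 1) = 0 ∧ y i = 1 ∧ y (i + 1) = 1)) ∧
        (Nat.testBit k 6 = false →
          ∀ i : ZMod n, ¬(y (i - 1) = 1 ∧ y i = 1 ∧ y (i + 1) = 0)) ∧
        (Nat.testBit k 7 = false →
          ∀ i : ZMod n, ¬(y (i - 1) = 1 ∧ y i = 1 ∧ y (i + 1) = 1))} := by
  have : Fact (1 < n) := ⟨by omega⟩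
  have hk' : TogglesIsolated k := by
    rcases hk with rfl | rfl | rfl | rfl | rfl <;> unfold TogglesIsolated <;> decide
  rw [perSet_eq_setOf_not_erodes hk' hω]
  exact Set.ext forall_not_erodes_iff
end
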